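/- Let ψ_1, …, ψ_m ∈ [0, π] be angles such that for every integer n ≥ 1, |Σ_{i=1}^m sym_n(ψ_i)| ≤ nσ for some real σ ≥ 2, where sym_n(ϑ) = sin((n+1)ϑ)/sin(ϑ). Then uniformly over [α,β] ⊆ [0,π], #{i : ψ_i ∈ [α,β]} = μ_ST(α,β)·m + O(√(mσ)). -/

import Mathlib

/-- `sym n θ = sin((n+1)θ)/sin θ`, extended by continuity at `θ = 0, π`. -/
noncomputable def symAngle (n : ℕ) (θ : ℝ) : ℝ :=
  if θ = 0 then n + 1
  else if θ = Real.pi then (-1) ^ n * (n + 1)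
  else Real.sin ((n + 1) * θ) / Real.sin θ

section SatoTateAux
open Real
noncomputable def stW (δ : ℝ) (n : ℕ) : ℝ := (2 - 2 * cos (n * δ)) / (n * δ) ^ 2

noncomputable def stMeas (a : ℝ) : ℝ := (a - sin a * cos a) / π

lemma st_congr {f g : ℕ → ℝ} {a b : ℝ} (h : HasSum f a) (h1 : ∀ n, g n = f n) (h2 : b = a) :
    HasSum g b := by
  rw [h2, funext h1]; exact h

lemma st_W_nonneg (δ : ℝ) (n : ℕ) : 0 ≤ stW δ n := by
  unfold stW
  have := cos_le_one (n * δ)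
  apply div_nonneg (by linarith) (sq_nonneg _)

lemma st_sum_cube {y : ℝ} (h0 : 0 ≤ y) (h1 : y ≤ 2 * π) :
    HasSum (fun n : ℕ => sin (n * y) / (n:ℝ) ^ 3) (π ^ 2 * y / 6 - π * y ^ 2 / 4 + y ^ 3 / 12) := by
  have hp := pi_pos
  have hx : y / (2 * π) ∈ Set.Icc (0:ℝ) 1 := ⟨by positivity, by rw [div_le_one (by positivity)]; exact h1⟩
  have h := hasSum_one_div_nat_pow_mul_sin (k := 1) one_ne_zero hx
  refine st_congr h ?_ ?_
  · intro n
    have : 2 * π * n * (y / (2 * π)) = n * y := by field_simp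
    rw [this]; ring
  · have e : (Polynomial.map (algebraMap ℚ ℝ) (Polynomial.bernoulli (2 * 1 + 1))).eval (y / (2*π))
        = (y / (2*π)) ^ 3 - 3/2 * (y / (2*π))^2 + 1/2 * (y / (2*π)) := by
      norm_num [Polynomial.bernoulli, Finset.sum_range_succ, bernoulli_eq_bernoulli'_of_ne_one, bernoulli_one, Nat.choose, bernoulli'_two, Polynomial.eval_monomial, bernoulli'_three]
      ring_nf
    rw [e]
    norm_num [Nat.factorial]
    field_simp
    ring

lemma st_sum_sq {y : ℝ} (h0 : 0 ≤ y) (h1 : y ≤ 2 * π) :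
    HasSum (fun n : ℕ => cos (n * y) / (n:ℝ) ^ 2) (π ^ 2 / 6 - π * y / 2 + y ^ 2 / 4) := by
  have hp := pi_pos
  have hx : y / (2 * π) ∈ Set.Icc (0:ℝ) 1 := ⟨by positivity, by rw [div_le_one (by positivity)]; exact h1⟩
  have h := hasSum_one_div_nat_pow_mul_cos (k := 1) one_ne_zero hx
  refine st_congr h ?_ ?_
  · intro n
    have : 2 * π * n * (y / (2 * π)) = n * y := by field_simp
    rw [this]; ring
  · have e : (Polynomial.map (algebraMap ℚ ℝ) (Polynomial.bernoulli (2 * 1))).eval (y / (2*π))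
        = (y / (2*π)) ^ 2 - (y / (2*π)) + 1/6 := by
      norm_num [Polynomial.bernoulli, Finset.sum_range_succ, bernoulli_eq_bernoulli'_of_ne_one, bernoulli_one, Nat.choose, bernoulli'_two, Polynomial.eval_monomial]
      ring_nf
    rw [e]
    norm_num [Nat.factorial]
    field_simp
    ring

lemma st_sum_W {δ : ℝ} (h0 : 0 < δ) (h1 : δ ≤ 1) : HasSum (stW δ) (π / δ - 1 / 2) := by
  have hp := pi_gt_three
  have A := st_sum_sq (y := 0) le_rfl (by linarith)
  have B := st_sum_sq (y := δ) h0.le (by linarith)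
  refine st_congr ((A.sub B).mul_left (2 / δ ^ 2)) ?_ ?_
  · intro n
    unfold stW
    simp only [mul_zero, cos_zero]
    field_simp
  · field_simp
    ring

lemma st_second_diff {δ : ℝ} (h0 : 0 < δ) {y u v w : ℝ}
    (hu : HasSum (fun n : ℕ => sin (n * (y + δ)) / (n:ℝ) ^ 3) u)
    (hv : HasSum (fun n : ℕ => sin (n * y) / (n:ℝ) ^ 3) v)
    (hw : HasSum (fun n : ℕ => sin (n * (y - δ)) / (n:ℝ) ^ 3) w) :
    HasSum (fun n : ℕ => sin (n * y) / n * stW δ n) ((2 * v - u - w) / δ ^ 2) := by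
  refine st_congr ((((hv.mul_left 2).sub hu).sub hw).mul_left (1 / δ ^ 2)) ?_ ?_
  · intro n
    unfold stW
    rw [mul_add, mul_sub (n:ℝ) y δ, sin_add, sin_sub]
    rcases Nat.eq_zero_or_pos n with rfl | hn
    · simp
    · have : (n:ℝ) ≠ 0 := by positivity
      field_simp
      ring
  · ring

lemma st_saw_out {δ : ℝ} (h0 : 0 < δ) {y : ℝ} (hy : δ ≤ y) (hy' : y ≤ 2 * π - δ) :
    HasSum (fun n : ℕ => sin (n * y) / n * stW δ n) ((π - y) / 2) := by
  convert st_second_diff h0 (st_sum_cube (y := y + δ) (by linarith) (by linarith))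
    (st_sum_cube (y := y) (by linarith) (by linarith))
    (st_sum_cube (y := y - δ) (by linarith) (by linarith)) using 1
  field_simp
  ring

lemma st_saw_in {δ : ℝ} (h0 : 0 < δ) (h1 : δ ≤ 1) {y : ℝ} (hy : 0 ≤ y) (hy' : y ≤ δ) :
    HasSum (fun n : ℕ => sin (n * y) / n * stW δ n)
      ((π - y) / 2 - π / 2 * ((δ - y) / δ) ^ 2) := by
  have hp := pi_gt_three
  have hneg : HasSum (fun n : ℕ => sin (n * (y - δ)) / (n:ℝ) ^ 3)
      (-(π ^ 2 * (δ - y) / 6 - π * (δ - y) ^ 2 / 4 + (δ - y) ^ 3 / 12)) := by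
    refine st_congr (st_sum_cube (y := δ - y) (by linarith) (by linarith)).neg ?_ rfl
    intro n
    rw [show (n:ℝ) * (y - δ) = -(n * (δ - y)) by ring, sin_neg, neg_div]
  convert st_second_diff h0 (st_sum_cube (y := y + δ) (by linarith) (by linarith))
    (st_sum_cube (y := y) (by linarith) (by linarith)) hneg using 1
  field_simp
  ring

lemma st_saw_neg {δ y v : ℝ} (h : HasSum (fun n : ℕ => sin (n * y) / n * stW δ n) v) :
    HasSum (fun n : ℕ => sin (n * (-y)) / n * stW δ n) (-v) := by
  refine st_congr h.neg ?_ rfl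
  intro n
  rw [mul_neg, sin_neg]; ring

/-- near `0`, the smoothed sawtooth lies between the two branches -/
lemma st_saw_mid {δ : ℝ} (h0 : 0 < δ) (h1 : δ ≤ 1) {y : ℝ} (hy : |y| ≤ δ) :
    ∃ v, HasSum (fun n : ℕ => sin (n * y) / n * stW δ n) v ∧
      -(π + y) / 2 ≤ v ∧ v ≤ (π - y) / 2 := by
  have hp := pi_gt_three
  have key : ∀ z, 0 ≤ z → z ≤ δ → 0 ≤ π / 2 * ((δ - z) / δ) ^ 2 ∧ π / 2 * ((δ - z) / δ) ^ 2 ≤ π / 2 := by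
    intro z hz hz'
    refine ⟨by positivity, ?_⟩
    have : ((δ - z) / δ) ^ 2 ≤ 1 := by
      apply pow_le_one₀
      · apply div_nonneg <;> linarith
      · rw [div_le_one h0]; linarith
    nlinarith
  have hy2 := abs_le.1 hy
  rcases le_total 0 y with h | h
  · obtain ⟨k1, k2⟩ := key y h hy2.2
    exact ⟨_, st_saw_in h0 h1 h hy2.2, by linarith, by linarith⟩
  · obtain ⟨k1, k2⟩ := key (-y) (by linarith) (by linarith)
    have := st_saw_neg (st_saw_in h0 h1 (y := -y) (by linarith) (by linarith))
    rw [neg_neg] at this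
    exact ⟨_, this, by linarith, by linarith⟩

lemma st_H {δ : ℝ} (h0 : 0 < δ) (h1 : δ ≤ 1) {a x : ℝ} (ha : δ ≤ a) (ha' : a ≤ π - δ)
    (hx : 0 ≤ x) (hx' : x ≤ π) :
    ∃ H, HasSum (fun n : ℕ => cos (n * x) * (sin (n * a) / n * stW δ n)) (π / 2 * (H - a / π)) ∧
      0 ≤ H ∧ H ≤ 1 ∧ (x ≤ a - δ → H = 1) ∧ (a + δ ≤ x → H = 0) := by
  have hp := pi_gt_three
  have hP := st_saw_out h0 (y := x + a) (by linarith) (by linarith)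
  have comb : ∀ v, HasSum (fun n : ℕ => sin (n * (x - a)) / n * stW δ n) v →
      HasSum (fun n : ℕ => cos (n * x) * (sin (n * a) / n * stW δ n))
        (π / 2 * (((π - (x - a)) / 2 - v) / π - a / π)) := by
    intro v hv
    refine st_congr ((hP.sub hv).mul_left (1 / 2)) ?_ ?_
    · intro n
      rw [mul_add, mul_sub (n:ℝ) x a, sin_add, sin_sub]; ring
    · field_simp; ring
  rcases le_or_gt (x - a) (-δ) with h | h
  · have := st_saw_neg (st_saw_out h0 (y := a - x) (by linarith) (by linarith))
    rw [neg_sub] at this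
    have e : ((π - (x - a)) / 2 - -((π - (a - x)) / 2)) / π = 1 := by field_simp; ring
    have := comb _ this
    rw [e] at this
    exact ⟨1, this, by norm_num, le_rfl, fun _ => rfl, fun h' => by linarith⟩
  rcases le_or_gt δ (x - a) with h' | h'
  · have := comb _ (st_saw_out h0 (y := x - a) (by linarith) (by linarith))
    rw [sub_self, zero_div] at this
    exact ⟨0, this, le_rfl, by norm_num, fun h' => by linarith, fun _ => rfl⟩
  · obtain ⟨v, hv, v1, v2⟩ := st_saw_mid h0 h1 (y := x - a) (abs_le.2 ⟨h.le, h'.le⟩)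
    refine ⟨_, comb v hv, div_nonneg (by linarith) (by linarith), ?_, fun _ => by linarith, fun _ => by linarith⟩
    rw [div_le_one (by linarith)]; linarith

lemma st_M_lip {a b : ℝ} (h : a ≤ b) : |stMeas b - stMeas a| ≤ b - a := by
  have hp := pi_gt_three
  have h1 := abs_le.1 (abs_sin_sub_sin_le (2 * b) (2 * a))
  rw [abs_of_nonneg (by linarith : 0 ≤ 2 * b - 2 * a), sin_two_mul, sin_two_mul] at h1
  have e : stMeas b - stMeas a = ((b - a) - (sin b * cos b - sin a * cos a)) / π := by
    unfold stMeas; ring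
  rw [e, abs_div, abs_of_pos pi_pos, div_le_iff₀ pi_pos, abs_le]
  constructor <;> nlinarith [h1.1, h1.2]

lemma st_W_two {δ : ℝ} (h0 : 0 < δ) (h1 : δ ≤ 1) : |1 - stW δ 2| ≤ δ := by
  have e : stW δ 2 = (sin δ / δ) ^ 2 := by
    unfold stW
    push_cast
    rw [cos_two_mul, cos_sq']
    field_simp
    ring
  have s1 := sin_gt_sub_cube h0
  have s2 := sin_lt h0
  have q1 : sin δ / δ ≤ 1 := by rw [div_le_one h0]; exact s2.le
  have q2 : 1 - δ / 6 ≤ sin δ / δ := by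
    rw [le_div_iff₀ h0]
    nlinarith [mul_pos h0 h0]
  rw [e, abs_le]
  constructor <;> nlinarith

lemma st_cos_sym (k : ℕ) {θ : ℝ} (h0 : 0 ≤ θ) (h1 : θ ≤ π) :
    2 * cos (((k + 2 : ℕ) : ℝ) * θ) = symAngle (k + 2) θ - symAngle k θ := by
  unfold symAngle
  have hp := pi_pos
  by_cases hz : θ = 0
  · simp [hz]
  by_cases hq : θ = π
  · rw [if_neg hz, if_pos hq, if_neg hz, if_pos hq, hq, cos_nat_mul_pi]
    push_cast; ring
  rw [if_neg hz, if_neg hq, if_neg hz, if_neg hq]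
  have hs : 0 < sin θ := sin_pos_of_pos_of_lt_pi (lt_of_le_of_ne h0 (Ne.symm hz)) (lt_of_le_of_ne h1 hq)
  have e1 : (((k + 2 : ℕ) : ℝ) + 1) * θ = ((k + 2 : ℕ) : ℝ) * θ + θ := by ring
  have e2 : ((k:ℝ) + 1) * θ = ((k + 2 : ℕ) : ℝ) * θ - θ := by push_cast; ring
  rw [e1, e2, sin_add, sin_sub]
  field_simp
  ring

lemma st_cos_sym_one {θ : ℝ} (h0 : 0 ≤ θ) (h1 : θ ≤ π) :
    2 * cos θ = symAngle 1 θ := by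
  unfold symAngle
  have hp := pi_pos
  by_cases hz : θ = 0
  · simp [hz]; norm_num
  by_cases hq : θ = π
  · rw [if_neg hz, if_pos hq, hq, cos_pi]
    norm_num
  rw [if_neg hz, if_neg hq]
  have hs : 0 < sin θ := sin_pos_of_pos_of_lt_pi (lt_of_le_of_ne h0 (Ne.symm hz)) (lt_of_le_of_ne h1 hq)
  have e1 : ((1 : ℕ) + 1 : ℝ) * θ = 2 * θ := by push_cast; ring
  rw [e1, sin_two_mul]
  field_simp

lemma st_sym_zero {θ : ℝ} (h0 : 0 ≤ θ) (h1 : θ ≤ π) : symAngle 0 θ = 1 := by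
  unfold symAngle
  by_cases hz : θ = 0
  · simp [hz]
  by_cases hq : θ = π
  · rw [if_neg hz, if_pos hq]; norm_num
  rw [if_neg hz, if_neg hq]
  have hs : 0 < sin θ := sin_pos_of_pos_of_lt_pi (lt_of_le_of_ne h0 (Ne.symm hz)) (lt_of_le_of_ne h1 hq)
  simp [hs.ne']

lemma st_cos_sum {m : ℕ} {ψ : Fin m → ℝ} {σ : ℝ} (hσ : 2 ≤ σ)
    (hψ : ∀ i, ψ i ∈ Set.Icc 0 π)
    (hS : ∀ n : ℕ, 1 ≤ n → |∑ i, symAngle n (ψ i)| ≤ n * σ) (n : ℕ) (hn : 1 ≤ n) :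
    |∑ i, cos (n * ψ i) + (if n = 2 then (m:ℝ) / 2 else 0)| ≤ n * σ := by
  obtain rfl | rfl | hn3 : n = 1 ∨ n = 2 ∨ 3 ≤ n := by omega
  · have h := hS 1 le_rfl
    rw [← Finset.sum_congr rfl (fun i _ => st_cos_sym_one (hψ i).1 (hψ i).2), ← Finset.mul_sum,
      abs_mul] at h
    norm_num at h ⊢
    nlinarith [abs_nonneg (∑ i, cos (ψ i))]
  · have h := hS 2 (by norm_num)
    have e : ∑ i, symAngle 2 (ψ i) = 2 * (∑ i, cos ((2:ℕ) * ψ i) + (m:ℝ) / 2) := by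
      rw [mul_add, Finset.mul_sum, Finset.sum_congr rfl (fun i _ => st_cos_sym 0 (hψ i).1 (hψ i).2),
        Finset.sum_sub_distrib, Finset.sum_congr (s₁ := Finset.univ) (f := fun i => symAngle 0 (ψ i)) rfl (fun i _ => st_sym_zero (hψ i).1 (hψ i).2)]
      simp
      ring
    rw [e, abs_mul, abs_two] at h
    rw [if_pos rfl]
    nlinarith [abs_nonneg (∑ i, cos ((2:ℕ) * ψ i) + (m:ℝ) / 2)]
  · obtain ⟨k, rfl⟩ : ∃ k, n = k + 2 := ⟨n - 2, by omega⟩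
    have h := abs_le.1 (hS (k + 2) (by omega))
    have h' := abs_le.1 (hS k (by omega))
    have e : 2 * ∑ i, cos (((k + 2 : ℕ) : ℝ) * ψ i)
        = ∑ i, symAngle (k + 2) (ψ i) - ∑ i, symAngle k (ψ i) := by
      rw [Finset.mul_sum, Finset.sum_congr rfl (fun i _ => st_cos_sym k (hψ i).1 (hψ i).2),
        Finset.sum_sub_distrib]
    rw [if_neg (by omega), add_zero, abs_le]
    push_cast at *
    constructor <;> nlinarith [h.1, h.2, h'.1, h'.2]

lemma st_smooth {m : ℕ} {ψ : Fin m → ℝ} {σ : ℝ} (hσ : 2 ≤ σ)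
    (hψ : ∀ i, ψ i ∈ Set.Icc 0 π)
    (hS : ∀ n : ℕ, 1 ≤ n → |∑ i, symAngle n (ψ i)| ≤ n * σ)
    {δ : ℝ} (h0 : 0 < δ) (h1 : δ ≤ 1) {a : ℝ} (ha : δ ≤ a) (ha' : a ≤ π - δ) :
    ∃ H : Fin m → ℝ, (∀ i, 0 ≤ H i ∧ H i ≤ 1 ∧ (ψ i ≤ a - δ → H i = 1) ∧ (a + δ ≤ ψ i → H i = 0)) ∧
      |∑ i, H i - m * stMeas a| ≤ 2 * σ / δ + m * δ := by
  have hp := pi_gt_three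
  choose H hH hH' using fun i => st_H h0 h1 ha ha' (hψ i).1 (hψ i).2
  refine ⟨H, hH', ?_⟩
  set b : ℕ → ℝ := fun n => sin (n * a) / n * stW δ n with hb
  have s1 := hasSum_sum (s := Finset.univ) (fun i _ => hH i)
  have s2 : HasSum (fun n : ℕ => if n = 2 then (m:ℝ) / 2 * b 2 else 0) ((m:ℝ) / 2 * b 2) :=
    hasSum_ite_eq 2 _
  have s3 := s1.add s2
  have hbd : ∀ n : ℕ, ‖(∑ i, cos (n * ψ i) * (sin (n * a) / n * stW δ n))
      + (if n = 2 then (m:ℝ) / 2 * b 2 else 0)‖ ≤ σ * stW δ n := by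
    intro n
    have e : (∑ i, cos (n * ψ i) * (sin (n * a) / n * stW δ n))
      + (if n = 2 then (m:ℝ) / 2 * b 2 else 0)
      = (∑ i, cos (n * ψ i) + (if n = 2 then (m:ℝ) / 2 else 0)) * b n := by
      rw [add_mul, Finset.sum_mul]
      congr 1
      split_ifs with h
      · rw [h]
      · simp
    rw [e, norm_mul, norm_eq_abs, norm_eq_abs]
    have hw := st_W_nonneg δ n
    rcases Nat.eq_zero_or_pos n with rfl | hn
    · simp only [hb]
      simp
      apply mul_nonneg (by linarith)
      exact_mod_cast hw
    · have hc := st_cos_sum hσ hψ hS n hn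
      have hn' : (0:ℝ) < n := by exact_mod_cast hn
      have hbn : |b n| ≤ stW δ n / n := by
        simp only [hb]
        rw [abs_mul, abs_div, abs_of_nonneg hw, abs_of_pos hn', div_mul_eq_mul_div]
        gcongr
        have := abs_sin_le_one (n * a)
        nlinarith
      calc _ ≤ (n * σ) * (stW δ n / n) := by gcongr
        _ = _ := by field_simp
  have s4 := tsum_of_norm_bounded ((st_sum_W h0 h1).mul_left σ) hbd
  rw [s3.tsum_eq, norm_eq_abs] at s4
  have e2 : b 2 = sin a * cos a * stW δ 2 := by
    simp only [hb]
    push_cast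
    rw [sin_two_mul]; ring
  have e3 : ∑ i, π / 2 * (H i - a / π) = π / 2 * ∑ i, H i - m * a / 2 := by
    rw [← Finset.mul_sum, Finset.sum_sub_distrib]
    simp
    field_simp
  rw [e2, e3] at s4
  have e4 : ∑ i, H i - m * stMeas a = (2 / π) * (π / 2 * ∑ i, H i - m * a / 2 + m / 2 * (sin a * cos a * stW δ 2))
      + (1 / π) * (m * (sin a * cos a * (1 - stW δ 2))) := by
    unfold stMeas; field_simp; ring
  have t1 : |sin a * cos a * (1 - stW δ 2)| ≤ δ := by
    rw [abs_mul, abs_mul]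
    have x1 := abs_sin_le_one a
    have x2 := abs_cos_le_one a
    have x3 := st_W_two h0 h1
    calc |sin a| * |cos a| * |1 - stW δ 2| ≤ 1 * 1 * δ := by gcongr
      _ = δ := by ring
  rw [e4]
  refine (abs_add_le _ _).trans ?_
  gcongr
  · rw [abs_mul, abs_of_pos (by positivity : 0 < 2 / π)]
    calc _ ≤ 2 / π * (σ * (π / δ - 1 / 2)) := by gcongr
      _ ≤ 2 / π * (σ * (π / δ)) := by gcongr; linarith
      _ = 2 * σ / δ := by field_simp
  · rw [abs_mul, abs_mul, abs_of_pos (by positivity : 0 < 1 / π), Nat.abs_cast]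
    have : 1 / π ≤ 1 := by rw [div_le_one pi_pos]; linarith
    calc _ ≤ 1 * (m * δ) := by gcongr
      _ = _ := one_mul _

lemma st_card {m : ℕ} (p : Fin m → Prop) [DecidablePred p] :
    ((Finset.univ.filter p).card : ℝ) = ∑ i, if p i then (1:ℝ) else 0 := by
  simp

lemma st_M_zero : stMeas 0 = 0 := by simp [stMeas]
lemma st_M_pi : stMeas π = 1 := by simp [stMeas, pi_ne_zero]

open Classical in
lemma st_upper {m : ℕ} {ψ : Fin m → ℝ} {σ : ℝ} (hσ : 2 ≤ σ)
    (hψ : ∀ i, ψ i ∈ Set.Icc 0 π)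
    (hS : ∀ n : ℕ, 1 ≤ n → |∑ i, symAngle n (ψ i)| ≤ n * σ)
    {δ : ℝ} (h0 : 0 < δ) (h1 : δ ≤ 1) {a : ℝ} (ha : 0 ≤ a) (ha' : a ≤ π) :
    ∑ i, (if ψ i ≤ a then (1:ℝ) else 0) ≤ m * stMeas a + (2 * σ / δ + 2 * (m * δ)) := by
  have hm : (0:ℝ) ≤ m := m.cast_nonneg
  rcases le_or_gt a (π - 2 * δ) with h | h
  · obtain ⟨H, hH, hE⟩ := st_smooth hσ hψ hS h0 h1 (a := a + δ) (by linarith) (by linarith)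
    have hl : ∑ i, (if ψ i ≤ a then (1:ℝ) else 0) ≤ ∑ i, H i := by
      apply Finset.sum_le_sum
      intro i _
      split_ifs with hi
      · rw [(hH i).2.2.1 (by linarith)]
      · exact (hH i).1
    have hM := (abs_le.1 (st_M_lip (by linarith : a ≤ a + δ))).2
    have := (abs_le.1 hE).2
    nlinarith
  · have hl : ∑ i, (if ψ i ≤ a then (1:ℝ) else 0) ≤ ∑ i : Fin m, (1:ℝ) := by
      apply Finset.sum_le_sum
      intro i _
      split_ifs <;> norm_num
    simp only [Finset.sum_const, Finset.card_univ, Fintype.card_fin, nsmul_eq_mul, mul_one] at hl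
    have hM := (abs_le.1 (st_M_lip ha')).2
    rw [st_M_pi] at hM
    have : 0 ≤ 2 * σ / δ := by positivity
    nlinarith

open Classical in
lemma st_lower {m : ℕ} {ψ : Fin m → ℝ} {σ : ℝ} (hσ : 2 ≤ σ)
    (hψ : ∀ i, ψ i ∈ Set.Icc 0 π)
    (hS : ∀ n : ℕ, 1 ≤ n → |∑ i, symAngle n (ψ i)| ≤ n * σ)
    {δ : ℝ} (h0 : 0 < δ) (h1 : δ ≤ 1) {a : ℝ} (ha : 0 ≤ a) (ha' : a ≤ π) :
    m * stMeas a - (2 * σ / δ + 2 * (m * δ)) ≤ ∑ i, (if ψ i < a then (1:ℝ) else 0) := by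
  have hm : (0:ℝ) ≤ m := m.cast_nonneg
  rcases le_or_gt (2 * δ) a with h | h
  · obtain ⟨H, hH, hE⟩ := st_smooth hσ hψ hS h0 h1 (a := a - δ) (by linarith) (by linarith)
    have hl : ∑ i, H i ≤ ∑ i, (if ψ i < a then (1:ℝ) else 0) := by
      apply Finset.sum_le_sum
      intro i _
      split_ifs with hi
      · exact (hH i).2.1
      · rw [(hH i).2.2.2 (by linarith)]
    have hM := (abs_le.1 (st_M_lip (by linarith : a - δ ≤ a))).2
    have := (abs_le.1 hE).1
    nlinarith
  · have hl : 0 ≤ ∑ i, (if ψ i < a then (1:ℝ) else 0) := by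
      apply Finset.sum_nonneg
      intro i _
      split_ifs <;> norm_num
    have hM := (abs_le.1 (st_M_lip ha)).2
    rw [st_M_zero] at hM
    have : 0 ≤ 2 * σ / δ := by positivity
    nlinarith

lemma st_integral (α β : ℝ) :
    (2 / π) * ∫ ϑ in α..β, sin ϑ ^ 2 = stMeas β - stMeas α := by
  rw [integral_sin_sq]; unfold stMeas; field_simp; ring

end SatoTateAux

open Classical in
theorem satoTate_discrepancy :
    ∃ C > (0:ℝ), ∀ (m : ℕ) (ψ : Fin m → ℝ) (σ : ℝ),
      2 ≤ σ →
      (∀ i, ψ i ∈ Set.Icc 0 Real.pi) →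
      (∀ n : ℕ, 1 ≤ n → |∑ i, symAngle n (ψ i)| ≤ n * σ) →
      ∀ α β : ℝ, 0 ≤ α → α ≤ β → β ≤ Real.pi →
        |((Finset.univ.filter (fun i : Fin m => ψ i ∈ Set.Icc α β)).card : ℝ)
            - ((2 / Real.pi) * ∫ ϑ in α..β, Real.sin ϑ ^ 2) * m|
          ≤ C * Real.sqrt (m * σ) := by
  refine ⟨8, by norm_num, ?_⟩
  intro m ψ σ hσ hψ hS α β hα hαβ hβ
  rw [st_integral, st_card]
  have hm : (0:ℝ) ≤ m := m.cast_nonneg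
  rcases le_or_gt σ m with h | h
  · have hm0 : (0:ℝ) < m := by linarith
    have hσ0 : 0 < σ := by linarith
    set δ := Real.sqrt (σ / m) with hδ
    have h0 : 0 < δ := Real.sqrt_pos.2 (by positivity)
    have h1 : δ ≤ 1 := by
      rw [hδ, Real.sqrt_le_iff, one_pow, div_le_one hm0]; exact ⟨zero_le_one, h⟩
    have hδ2 : δ ^ 2 = σ / m := Real.sq_sqrt (by positivity)
    have e1 : Real.sqrt (m * σ) = m * δ := by
      rw [show (m:ℝ) * σ = (m * δ) ^ 2 by rw [mul_pow, hδ2]; field_simp]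
      exact Real.sqrt_sq (by positivity)
    have e2 : 2 * σ / δ = 2 * (m * δ) := by
      rw [div_eq_iff h0.ne']
      have : σ = δ ^ 2 * m := by rw [hδ2]; field_simp
      rw [this]; ring
    have e3 : ∑ i, (if ψ i ∈ Set.Icc α β then (1:ℝ) else 0)
        = ∑ i, (if ψ i ≤ β then (1:ℝ) else 0) - ∑ i, (if ψ i < α then (1:ℝ) else 0) := by
      rw [← Finset.sum_sub_distrib]
      apply Finset.sum_congr rfl
      intro i _
      simp only [Set.mem_Icc]
      by_cases c1 : ψ i < α
      · rw [if_neg (by intro hh; linarith [hh.1]), if_pos (by linarith), if_pos c1]; norm_num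
      · by_cases c2 : ψ i ≤ β
        · rw [if_pos ⟨by linarith, c2⟩, if_pos c2, if_neg c1]; norm_num
        · rw [if_neg (fun hh => c2 hh.2), if_neg c2, if_neg c1]; norm_num
    have mono : ∀ a, ∑ i, (if ψ i < a then (1:ℝ) else 0) ≤ ∑ i, (if ψ i ≤ a then (1:ℝ) else 0) := by
      intro a
      apply Finset.sum_le_sum
      intro i _
      split_ifs <;> first | (exfalso; linarith) | norm_num
    have u1 := st_upper hσ hψ hS h0 h1 (a := α) hα (by linarith)
    have u2 := st_upper hσ hψ hS h0 h1 (a := β) (by linarith) hβ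
    have l1 := st_lower hσ hψ hS h0 h1 (a := α) hα (by linarith)
    have l2 := st_lower hσ hψ hS h0 h1 (a := β) (by linarith) hβ
    have m1 := mono α
    have m2 := mono β
    rw [e2] at u1 u2 l1 l2
    rw [e3, e1, abs_le]
    constructor <;> linarith
  · have hs : (m:ℝ) ≤ Real.sqrt (m * σ) := by
      apply Real.le_sqrt_of_sq_le
      nlinarith
    have p1 : 0 ≤ ∑ i, (if ψ i ∈ Set.Icc α β then (1:ℝ) else 0) := by
      apply Finset.sum_nonneg
      intro i _
      split_ifs <;> norm_num
    have p2 : ∑ i, (if ψ i ∈ Set.Icc α β then (1:ℝ) else 0) ≤ ∑ i : Fin m, (1:ℝ) := by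
      apply Finset.sum_le_sum
      intro i _
      split_ifs <;> norm_num
    simp only [Finset.sum_const, Finset.card_univ, Fintype.card_fin, nsmul_eq_mul, mul_one] at p2
    have hM := abs_le.1 (st_M_lip hαβ)
    have hp := Real.pi_lt_four
    have q1 : -4 * (m:ℝ) ≤ (stMeas β - stMeas α) * m := by nlinarith [hM.1]
    have q2 : (stMeas β - stMeas α) * m ≤ 4 * (m:ℝ) := by nlinarith [hM.2]
    rw [abs_le]
    constructor <;> linarith
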